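/- (Repovš–Skopenkov–Ščepin) Let K be a locally compact (possibly nonclosed) subset of ℝⁿ. If K is C¹-homogeneous, then K is a C¹-submanifold of ℝⁿ: for every x ∈ K there exist d ∈ ℕ, open sets O, O' ⊆ ℝⁿ with x ∈ O, and a C¹ diffeomorphism h : O → O' (h and h⁻¹ continuously differentiable) such that h(O ∩ K) = O' ∩ (ℝᵈ × {0}). -/

import Mathlib

open Set Metric Topology unitInterval

/-- `h` is a `C¹` diffeomorphism from the open set `O` onto the open set `O'`,
with inverse `h'`: both are continuously differentiable. -/
def IsC1DiffeoOn {E : Type*} [NormedAddCommGroup E] [NormedSpace ℝ E]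
    (h h' : E → E) (O O' : Set E) : Prop :=
  ContDiffOn ℝ 1 h O ∧ ContDiffOn ℝ 1 h' O' ∧ h '' O = O' ∧
  (∀ x ∈ O, h' (h x) = x) ∧ (∀ y ∈ O', h (h' y) = y)

/-- A subset `K ⊆ ℝⁿ` is `C¹`-homogeneous if any point of `K` can be carried to
any other point of `K` by a local `C¹` diffeomorphism of `ℝⁿ` preserving `K`. -/
def IsC1Homogeneous {n : ℕ} (K : Set (EuclideanSpace ℝ (Fin n))) : Prop :=
  ∀ x ∈ K, ∀ y ∈ K, ∃ (Ox Oy : Set (EuclideanSpace ℝ (Fin n)))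
    (h h' : EuclideanSpace ℝ (Fin n) → EuclideanSpace ℝ (Fin n)),
    IsOpen Ox ∧ IsOpen Oy ∧ x ∈ Ox ∧ y ∈ Oy ∧ IsC1DiffeoOn h h' Ox Oy ∧
    h '' (Ox ∩ K) = Oy ∩ K ∧ h x = y

open Filter Asymptotics

section Conormal

variable {E : Type*} [NormedAddCommGroup E] [NormedSpace ℝ E]

/-- The functionals whose difference quotients over pairs of points of `K` tend to `0` at `x`. -/
def conormal (K : Set E) (x : E) : Submodule ℝ (E →L[ℝ] ℝ) where
  carrier := {l | (fun q : E × E => l (q.1 - q.2)) =o[𝓝[K ×ˢ K] (x, x)] fun q => q.1 - q.2}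
  add_mem' ha hb := ha.add hb
  zero_mem' := isLittleO_zero _ _
  smul_mem' c _ h := h.const_mul_left c

/-- The functional `l` has no positive first-order growth at `x` along `K`. -/
def IsTouching (K : Set E) (x : E) (l : E →L[ℝ] ℝ) : Prop :=
  (fun y => max (l (y - x)) 0) =o[𝓝[K] x] fun y => y - x

theorem mem_conormal {K : Set E} {x : E} {l : E →L[ℝ] ℝ} :
    l ∈ conormal K x ↔
      (fun q : E × E => l (q.1 - q.2)) =o[𝓝[K ×ˢ K] (x, x)] fun q => q.1 - q.2 :=
  Iff.rfl

theorem isLittleO_of_mem_conormal {K : Set E} {x : E} {l : E →L[ℝ] ℝ} (hx : x ∈ K)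
    (h : l ∈ conormal K x) : (fun y => l (y - x)) =o[𝓝[K] x] fun y => y - x := by
  have ht : Tendsto (fun y : E => (y, x)) (𝓝[K] x) (𝓝[K ×ˢ K] (x, x)) := by
    rw [nhdsWithin_prod_eq]
    exact tendsto_id.prodMk (tendsto_const_nhdsWithin hx)
  exact (mem_conormal.1 h).comp_tendsto ht

theorem IsTouching.of_le {K : Set E} {x : E} {l l' : E →L[ℝ] ℝ} {g : E → E} {e : E → ℝ}
    (hl : (fun y => max (l (g y)) 0) =o[𝓝[K] x] fun y => y - x)
    (he : e =o[𝓝[K] x] fun y => y - x)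
    (h : ∀ y, l' (y - x) = l (g y) + e y) : IsTouching K x l' := by
  refine (isBigO_of_le _ fun y => ?_).trans_isLittleO (hl.add he.norm_left)
  rw [Real.norm_of_nonneg (le_max_right _ _), Real.norm_of_nonneg (by positivity), h]
  exact max_le (add_le_add (le_max_left _ _) (Real.le_norm_self _)) (by positivity)

theorem IsTouching.add_conormal {K : Set E} {x : E} {l e : E →L[ℝ] ℝ} (hx : x ∈ K)
    (h : IsTouching K x l) (he : e ∈ conormal K x) : IsTouching K x (l + e) :=
  IsTouching.of_le (g := fun y => y - x) h (isLittleO_of_mem_conormal hx he) fun _ => rfl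

/-- First-order data of a local diffeomorphism of `(E, K)` carrying `x` to `y`. -/
structure IsLocalMove (K : Set E) (x y : E) (h : E → E) (A : E →L[ℝ] E) : Prop where
  deriv : HasStrictFDerivAt h A x
  tendsto : Tendsto h (𝓝[K] x) (𝓝[K] y)
  map_eq : h x = y

theorem IsLocalMove.comp_mem_conormal {K : Set E} {x y : E} {h : E → E} {A : E →L[ℝ] E}
    (H : IsLocalMove K x y h A) {l : E →L[ℝ] ℝ} (hl : l ∈ conormal K y) :
    l.comp A ∈ conormal K x := by
  have ht : Tendsto (fun q : E × E => (h q.1, h q.2)) (𝓝[K ×ˢ K] (x, x)) (𝓝[K ×ˢ K] (y, y)) := by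
    rw [nhdsWithin_prod_eq, nhdsWithin_prod_eq]
    exact H.tendsto.prodMap H.tendsto
  have hle : 𝓝[K ×ˢ K] (x, x) ≤ 𝓝 (x, x) := nhdsWithin_le_nhds
  have h1 := ((mem_conormal.1 hl).comp_tendsto ht).trans_isBigO (H.deriv.isBigO_sub.mono hle)
  have h2 := (l.isBigO_comp _ _).trans_isLittleO (H.deriv.isLittleO.mono hle)
  refine mem_conormal.2 ((h1.sub h2).congr_left fun q => ?_)
  simp

theorem IsLocalMove.comp_isTouching {K : Set E} {x y : E} {h : E → E} {A : E →L[ℝ] E}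
    (H : IsLocalMove K x y h A) {l : E →L[ℝ] ℝ} (hl : IsTouching K y l) :
    IsTouching K x (l.comp A) := by
  have hle : 𝓝[K] x ≤ 𝓝 x := nhdsWithin_le_nhds
  have hd := H.deriv.hasFDerivAt
  have hO : (fun z => h z - y) =O[𝓝[K] x] fun z => z - x := by
    simpa [H.map_eq] using hd.isBigO_sub.mono hle
  have h1 := (IsLittleO.comp_tendsto hl H.tendsto).trans_isBigO hO
  have h2 := (l.isBigO_comp _ _).trans_isLittleO (hd.isLittleO.mono hle)
  refine IsTouching.of_le (g := fun z => h z - y) h1 h2.neg_left fun z => ?_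
  simp [H.map_eq]

/-- First-order data of a local diffeomorphism, together with its inverse. -/
def HasMove (K : Set E) (x y : E) : Prop :=
  ∃ (A : E ≃L[ℝ] E) (h h' : E → E), IsLocalMove K x y h A ∧ IsLocalMove K y x h' A.symm

theorem HasMove.finrank_le [FiniteDimensional ℝ E] {K : Set E} {x y : E} (H : HasMove K x y) :
    Module.finrank ℝ (conormal K y) ≤ Module.finrank ℝ (conormal K x) := by
  obtain ⟨A, h, h', H1, -⟩ := H
  let f : conormal K y →ₗ[ℝ] conormal K x :=
    { toFun := fun l => ⟨l.1.comp (A : E →L[ℝ] E), H1.comp_mem_conormal l.2⟩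
      map_add' := fun _ _ => rfl
      map_smul' := fun _ _ => rfl }
  refine LinearMap.finrank_le_finrank_of_injective (f := f) fun a b hab => ?_
  ext v
  have : a.1 (A (A.symm v)) = b.1 (A (A.symm v)) := congrArg (fun l => l.1 (A.symm v)) hab
  simpa using this

theorem HasMove.exists_touching {K : Set E} {x y : E} (H : HasMove K x y) {l : E →L[ℝ] ℝ}
    (hl : IsTouching K y l) (hn : l ∉ conormal K y) :
    ∃ l', IsTouching K x l' ∧ l' ∉ conormal K x := by
  obtain ⟨A, h, h', H1, H2⟩ := H
  refine ⟨_, H1.comp_isTouching hl, fun hc => hn ?_⟩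
  convert H2.comp_mem_conormal hc
  ext v
  simp

end Conormal

theorem IsC1Homogeneous.hasMove {n : ℕ} {K : Set (EuclideanSpace ℝ (Fin n))}
    (hK : IsC1Homogeneous K) {x y : EuclideanSpace ℝ (Fin n)} (hx : x ∈ K) (hy : y ∈ K) :
    HasMove K x y := by
  obtain ⟨Ox, Oy, h, h', hOx, hOy, hxO, hyO, ⟨hc, hc', him, hl, hr⟩, hKK, hxy⟩ := hK x hx y hy
  have hyx : h' y = x := by rw [← hxy, hl x hxO]
  have hs := (hc.contDiffAt (hOx.mem_nhds hxO)).hasStrictFDerivAt one_ne_zero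
  have hs' := (hc'.contDiffAt (hOy.mem_nhds hyO)).hasStrictFDerivAt one_ne_zero
  have e1 : (fderiv ℝ h' y).comp (fderiv ℝ h x) = ContinuousLinearMap.id ℝ _ := by
    have := (hxy ▸ hs'.hasFDerivAt).comp x hs.hasFDerivAt
    rw [hxy] at this
    exact (this.congr_of_eventuallyEq (f₁ := id) (by
      filter_upwards [hOx.mem_nhds hxO] with z hz using (hl z hz).symm)).unique (hasFDerivAt_id x)
  have e2 : (fderiv ℝ h x).comp (fderiv ℝ h' y) = ContinuousLinearMap.id ℝ _ := by
    have := (hyx ▸ hs.hasFDerivAt).comp y hs'.hasFDerivAt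
    rw [hyx] at this
    exact (this.congr_of_eventuallyEq (f₁ := id) (by
      filter_upwards [hOy.mem_nhds hyO] with z hz using (hr z hz).symm)).unique (hasFDerivAt_id y)
  refine ⟨ContinuousLinearEquiv.equivOfInverse (fderiv ℝ h x) (fderiv ℝ h' y)
    (fun v => congrArg (· v) e1) (fun v => congrArg (· v) e2), h, h', ⟨hs, ?_, hxy⟩,
    ⟨hs', ?_, hyx⟩⟩
  · refine tendsto_nhdsWithin_iff.2 ⟨?_, ?_⟩
    · have := hs.continuousAt.tendsto
      rw [hxy] at this
      exact this.mono_left nhdsWithin_le_nhds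
    · filter_upwards [self_mem_nhdsWithin, nhdsWithin_le_nhds (hOx.mem_nhds hxO)] with z hz hzO
      exact (hKK ▸ mem_image_of_mem h ⟨hzO, hz⟩ : h z ∈ Oy ∩ K).2
  · refine tendsto_nhdsWithin_iff.2 ⟨?_, ?_⟩
    · have := hs'.continuousAt.tendsto
      rw [hyx] at this
      exact this.mono_left nhdsWithin_le_nhds
    · filter_upwards [self_mem_nhdsWithin, nhdsWithin_le_nhds (hOy.mem_nhds hyO)] with z hz hzO
      obtain ⟨w, hw, rfl⟩ : z ∈ h '' (Ox ∩ K) := hKK ▸ ⟨hzO, hz⟩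
      rw [hl w hw.1]
      exact hw.2

/-- Baire category theorem for relatively open pieces of a locally compact set. -/
theorem exists_open_subset_of_iUnion_closed {X : Type*} [TopologicalSpace X] [T2Space X]
    {K U : Set X} [LocallyCompactSpace K] (hU : IsOpen U) (hne : (K ∩ U).Nonempty)
    {ι : Type*} [Countable ι] {f : ι → Set X} (hf : ∀ i, IsClosed (f i))
    (hcov : K ∩ U ⊆ ⋃ i, f i) :
    ∃ i, ∃ V, IsOpen V ∧ V ⊆ U ∧ (K ∩ V).Nonempty ∧ K ∩ V ⊆ f i := by
  let g : ι → Set K := fun i => Subtype.val ⁻¹' (f i) ∪ (Subtype.val ⁻¹' U)ᶜ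
  have hU' : IsOpen (Subtype.val ⁻¹' U : Set K) := hU.preimage continuous_subtype_val
  have hg : ∀ i, IsClosed (g i) := fun i =>
    ((hf i).preimage continuous_subtype_val).union hU'.isClosed_compl
  obtain ⟨x, hxK, hxU⟩ := hne
  have hcovg : ⋃ i, g i = univ := by
    refine eq_univ_of_forall fun z => ?_
    by_cases hz : z.1 ∈ U
    · obtain ⟨i, hi⟩ := mem_iUnion.1 (hcov ⟨z.2, hz⟩)
      exact mem_iUnion.2 ⟨i, Or.inl hi⟩
    · obtain ⟨i, -⟩ := mem_iUnion.1 (hcov ⟨hxK, hxU⟩)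
      exact mem_iUnion.2 ⟨i, Or.inr hz⟩
  obtain ⟨z, hzU, hz⟩ := (dense_iUnion_interior_of_closed hg hcovg).inter_open_nonempty _ hU'
    ⟨⟨x, hxK⟩, hxU⟩
  obtain ⟨i, hi⟩ := mem_iUnion.1 hz
  obtain ⟨V, hV, hVi⟩ := isOpen_induced_iff.1 (isOpen_interior (s := g i))
  refine ⟨i, V ∩ U, hV.inter hU, inter_subset_right, ⟨z, z.2, ?_, hzU⟩, fun w hw => ?_⟩
  · have : z ∈ Subtype.val ⁻¹' V := hVi ▸ hi
    exact this
  · have : (⟨w, hw.1⟩ : K) ∈ interior (g i) := hVi ▸ hw.2.1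
    exact (interior_subset this).resolve_right fun h => h hw.2.2

theorem exists_family_transverse {V : Type*} [AddCommGroup V] [Module ℝ V] [FiniteDimensional ℝ V]
    (N : Submodule ℝ V) {k : ℕ} (hk : Module.finrank ℝ N + k = Module.finrank ℝ V) :
    ∃ c : Fin k → V, ∀ u : Fin k → ℝ, ∑ i, u i • c i ∈ N → ∀ i, u i = 0 := by
  obtain ⟨T, hT⟩ := N.exists_isCompl
  have hTk : Module.finrank ℝ T = k := by
    have := Submodule.finrank_add_eq_of_isCompl hT
    omega
  let b := Module.finBasisOfFinrankEq ℝ T hTk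
  refine ⟨fun i => b i, fun u hu => ?_⟩
  refine Fintype.linearIndependent_iff.1 b.linearIndependent u ?_
  have h : ((∑ i, u i • b i : T) : V) = ∑ i, u i • (b i : V) := by simp
  exact_mod_cast (Submodule.disjoint_def.1 hT.disjoint) _ (h ▸ hu) (∑ i, u i • b i : T).2

section Separation

variable {E F : Type*} [NormedAddCommGroup E] [NormedSpace ℝ E]
  [NormedAddCommGroup F] [InnerProductSpace ℝ F]

/-- The pairs of points of `K` whose secant is detected, with constant `ε`, by the functional
pulled back along `p` from `u`. -/
def secantSet (K : Set E) (p : E →L[ℝ] F) (ε : ℝ) (u : F) : Set (E × E) :=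
  {q : E × E | q ∈ K ×ˢ K ∧ ε * ‖q.1 - q.2‖ < |inner ℝ u (p (q.1 - q.2))|}

/-- The points near which secants of `K` are detected, with constant `ε`, by every unit functional
pulled back along `p`. -/
def separationSet (K : Set E) (p : E →L[ℝ] F) (ε : ℝ) : Set E :=
  {z | ∀ u : F, ‖u‖ = 1 → (z, z) ∈ closure (secantSet K p ε u)}

theorem secantSet_anti {K : Set E} {p : E →L[ℝ] F} {ε δ : ℝ} (h : δ ≤ ε) (u : F) :
    secantSet K p ε u ⊆ secantSet K p δ u := by
  rintro q ⟨hK, hq⟩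
  exact ⟨hK, (mul_le_mul_of_nonneg_right h (norm_nonneg _)).trans_lt hq⟩

theorem separationSet_anti {K : Set E} {p : E →L[ℝ] F} {ε δ : ℝ} (h : δ ≤ ε) :
    separationSet K p ε ⊆ separationSet K p δ :=
  fun _ hz u hu => closure_mono (secantSet_anti h u) (hz u hu)

theorem isClosed_separationSet (K : Set E) (p : E →L[ℝ] F) (ε : ℝ) :
    IsClosed (separationSet K p ε) := by
  simp only [separationSet, ofPred_forall]
  exact isClosed_iInter fun u => isClosed_iInter fun _ =>
    isClosed_closure.preimage (continuous_id.prodMk continuous_id)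

theorem abs_inner_sub_abs_inner_le (u v : F) (p q : E →L[ℝ] F) (w : E) :
    |inner ℝ u (p w)| - |inner ℝ v (q w)| ≤ (‖u - v‖ * ‖p‖ + ‖v‖ * ‖p - q‖) * ‖w‖ := by
  have h : inner ℝ u (p w) - inner ℝ v (q w) =
      inner ℝ (u - v) (p w) + inner ℝ v ((p - q) w) := by
    simp [inner_sub_left, inner_sub_right]
  refine (abs_sub_abs_le_abs_sub _ _).trans ?_
  rw [h, add_mul]
  refine (abs_add_le _ _).trans (add_le_add ?_ ?_)
  · refine (abs_real_inner_le_norm _ _).trans ?_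
    rw [mul_assoc]
    exact mul_le_mul_of_nonneg_left (p.le_opNorm w) (norm_nonneg _)
  · refine (abs_real_inner_le_norm _ _).trans ?_
    rw [mul_assoc]
    exact mul_le_mul_of_nonneg_left ((p - q).le_opNorm w) (norm_nonneg _)

theorem separationSet_subset_of_norm_sub_le {K : Set E} {p p' : E →L[ℝ] F} {ε : ℝ}
    (h : ‖p - p'‖ ≤ ε / 2) : separationSet K p ε ⊆ separationSet K p' (ε / 2) := by
  intro z hz u hu
  suffices H : secantSet K p ε u ⊆ secantSet K p' (ε / 2) u from closure_mono H (hz u hu)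
  intro q hq
  refine ⟨hq.1, ?_⟩
  have h1 := abs_inner_sub_abs_inner_le u u p p' (q.1 - q.2)
  have h2 := mul_le_mul_of_nonneg_right h (norm_nonneg (q.1 - q.2))
  have h3 := hq.2
  simp only [sub_self, norm_zero, zero_mul, hu, one_mul, zero_add] at h1
  linarith

theorem comp_notMem_conormal {K : Set E} {p : E →L[ℝ] F} {ε : ℝ} (hε : 0 < ε) {z : E}
    (hz : z ∈ separationSet K p ε) {u : F} (hu : u ≠ 0) :
    (innerSL ℝ u).comp p ∉ conormal K z := by
  intro hc
  have hu' : 0 < ‖u‖ := norm_pos_iff.2 hu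
  have h1 := (mem_conormal.1 hc).bound (c := ε * ‖u‖) (by positivity)
  have h2 := mem_closure_iff_frequently.1
    (hz (‖u‖⁻¹ • u) (by rw [norm_smul, norm_inv, norm_norm, inv_mul_cancel₀ hu'.ne']))
  obtain ⟨q, ⟨hqK, hq⟩, hq'⟩ := (h2.and_eventually (eventually_nhdsWithin_iff.1 h1)).exists
  have := hq' hqK
  simp only [ContinuousLinearMap.comp_apply, innerSL_apply_apply, Real.norm_eq_abs] at this
  rw [real_inner_smul_left, abs_mul, abs_inv, abs_norm, inv_mul_eq_div, lt_div_iff₀ hu'] at hq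
  linarith

theorem exists_mem_separationSet [FiniteDimensional ℝ F] {K : Set E} {p : E →L[ℝ] F} {z : E}
    (hp : ∀ u : F, u ≠ 0 → (innerSL ℝ u).comp p ∉ conormal K z) :
    ∃ ε > 0, z ∈ separationSet K p ε := by
  suffices H : ∃ ε > 0, ∀ u ∈ sphere (0 : F) 1, (z, z) ∈ closure (secantSet K p ε u) by
    obtain ⟨ε, hε, h⟩ := H
    exact ⟨ε, hε, fun u hu => h u (by simpa using hu)⟩
  refine (isCompact_sphere (0 : F) 1).induction_on
    (p := fun s => ∃ ε > 0, ∀ u ∈ s, (z, z) ∈ closure (secantSet K p ε u)) ?_ ?_ ?_ ?_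
  · exact ⟨1, one_pos, fun u hu => hu.elim⟩
  · rintro s t hst ⟨ε, hε, h⟩
    exact ⟨ε, hε, fun u hu => h u (hst hu)⟩
  · rintro s t ⟨ε, hε, h⟩ ⟨δ, hδ, h'⟩
    refine ⟨min ε δ, lt_min hε hδ, ?_⟩
    rintro u (hu | hu)
    · exact closure_mono (secantSet_anti (min_le_left _ _) u) (h u hu)
    · exact closure_mono (secantSet_anti (min_le_right _ _) u) (h' u hu)
  · intro u hu
    have hu0 : u ≠ 0 := by
      rintro rfl
      simp at hu
    have h1 := hp u hu0
    rw [mem_conormal, isLittleO_iff] at h1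
    push Not at h1
    obtain ⟨c, hc, h1⟩ := h1
    have hd : 0 < c / 2 / (‖p‖ + 1) := by positivity
    refine ⟨ball u (c / 2 / (‖p‖ + 1)), mem_nhdsWithin_of_mem_nhds (ball_mem_nhds _ hd),
      c / 2, by positivity, fun v hv => mem_closure_iff_frequently.2 ?_⟩
    refine (frequently_nhdsWithin_iff.1 h1).mono fun q hq => ⟨hq.2, ?_⟩
    have h2 := hq.1
    have h3 := abs_inner_sub_abs_inner_le u v p p (q.1 - q.2)
    have h4 : ‖u - v‖ * ‖p‖ ≤ c / 2 := by
      rw [mem_ball, dist_comm, dist_eq_norm, lt_div_iff₀ (by positivity)] at hv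
      nlinarith [norm_nonneg (u - v), norm_nonneg p]
    simp only [sub_self, norm_zero, mul_zero, add_zero] at h3
    simp only [ContinuousLinearMap.comp_apply, innerSL_apply_apply, Real.norm_eq_abs] at h2
    have h5 := mul_le_mul_of_nonneg_right h4 (norm_nonneg (q.1 - q.2))
    linarith

theorem finrank_continuousLinearMap_real [FiniteDimensional ℝ E] :
    Module.finrank ℝ (E →L[ℝ] ℝ) = Module.finrank ℝ E := by
  rw [← (LinearMap.toContinuousLinearMap (𝕜 := ℝ) (E := E) (F' := ℝ)).finrank_eq]
  exact Subspace.dual_finrank_eq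

theorem exists_projection_transverse [FiniteDimensional ℝ E] (N : Submodule ℝ (E →L[ℝ] ℝ)) {k : ℕ}
    (hk : Module.finrank ℝ N + k = Module.finrank ℝ E) :
    ∃ p : E →L[ℝ] EuclideanSpace ℝ (Fin k), ∀ u, u ≠ 0 → (innerSL ℝ u).comp p ∉ N := by
  obtain ⟨c, hc⟩ := exists_family_transverse N (hk.trans finrank_continuousLinearMap_real.symm)
  let p : E →L[ℝ] EuclideanSpace ℝ (Fin k) :=
    ((EuclideanSpace.equiv (Fin k) ℝ).symm : (Fin k → ℝ) →L[ℝ] _).comp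
      (ContinuousLinearMap.pi c)
  refine ⟨p, fun u hu hN => hu ?_⟩
  have h1 : (innerSL ℝ u).comp p = ∑ i, u i • c i := by
    ext w
    simp [p, PiLp.inner_apply, mul_comm]
  ext i
  exact hc u (h1 ▸ hN) i

theorem exists_sub_mem_conormal [FiniteDimensional ℝ E] [FiniteDimensional ℝ F]
    {N : Submodule ℝ (E →L[ℝ] ℝ)} {p : E →L[ℝ] F}
    (hk : Module.finrank ℝ N + Module.finrank ℝ F = Module.finrank ℝ E)
    (hp : ∀ u : F, u ≠ 0 → (innerSL ℝ u).comp p ∉ N) (l : E →L[ℝ] ℝ) :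
    ∃ u : F, ∃ e ∈ N, l = (innerSL ℝ u).comp p + e := by
  let f : F →ₗ[ℝ] (E →L[ℝ] ℝ) :=
    { toFun := fun u => (innerSL ℝ u).comp p
      map_add' := fun a b => by ext; simp
      map_smul' := fun a b => by ext; simp }
  have hdual := finrank_continuousLinearMap_real (E := E)
  have hf : Function.Injective f := by
    refine (injective_iff_map_eq_zero f).2 fun u hu => ?_
    by_contra h0
    exact hp u h0 (show f u ∈ N by rw [hu]; exact N.zero_mem)
  have hd : Disjoint (LinearMap.range f) N := by
    rw [Submodule.disjoint_def]
    rintro _ ⟨u, rfl⟩ hu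
    by_contra h0
    exact hp u (fun h => h0 (by rw [h, map_zero])) hu
  have hr := LinearMap.finrank_range_of_inj hf
  have htop := Submodule.eq_top_of_disjoint _ _ (by omega) hd
  obtain ⟨_, ⟨u, rfl⟩, e, he, h⟩ := Submodule.mem_sup.1 (htop ▸ Submodule.mem_top : l ∈ _)
  exact ⟨u, e, he, h.symm⟩

/-- Along `K`, secants near `z` are recovered to first order from their images under `p`. -/
theorem exists_linear_inverse_isLittleO [FiniteDimensional ℝ E] {K : Set E} {p : E →L[ℝ] F} {z : E}
    (h : ∀ l : E →L[ℝ] ℝ, ∃ u : F, ∃ e ∈ conormal K z, l = (innerSL ℝ u).comp p + e) :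
    ∃ L : F →L[ℝ] E, (fun q : E × E => (q.1 - q.2) - L (p (q.1 - q.2)))
      =o[𝓝[K ×ˢ K] (z, z)] fun q => q.1 - q.2 := by
  let b := Module.finBasis ℝ E
  choose u e he hue using fun i => h (LinearMap.toContinuousLinearMap (b.coord i))
  refine ⟨∑ i, (innerSL ℝ (u i)).smulRight (b i), ?_⟩
  have : (fun q : E × E => ∑ i, (e i (q.1 - q.2)) • b i)
      =o[𝓝[K ×ˢ K] (z, z)] fun q => q.1 - q.2 := by
    refine IsLittleO.fun_sum fun i _ => ?_
    refine IsBigO.trans_isLittleO ?_ (mem_conormal.1 (he i))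
    exact (ContinuousLinearMap.toSpanSingleton ℝ (b i)).isBigO_comp _ _
  refine this.congr_left fun q => ?_
  generalize q.1 - q.2 = w
  nth_rw 2 [← b.sum_repr w]
  have hi : ∀ i, b.repr w i = inner ℝ (u i) (p w) + e i w := fun i => by
    have := congrArg (fun l => l w) (hue i)
    simpa using this
  simp [hi, add_smul, Finset.sum_add_distrib]

end Separation

theorem exists_open_subset_separationSet {E : Type*} [NormedAddCommGroup E] [NormedSpace ℝ E]
    [FiniteDimensional ℝ E] {K : Set E} [LocallyCompactSpace K] (hne : K.Nonempty) {k : ℕ}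
    (hk : ∀ z ∈ K, Module.finrank ℝ (conormal K z) + k = Module.finrank ℝ E) :
    ∃ (p : E →L[ℝ] EuclideanSpace ℝ (Fin k)) (ε : ℝ) (U : Set E), 0 < ε ∧ IsOpen U ∧
      (K ∩ U).Nonempty ∧ K ∩ U ⊆ separationSet K p ε := by
  let d := TopologicalSpace.denseSeq (E →L[ℝ] EuclideanSpace ℝ (Fin k))
  obtain ⟨⟨i, j⟩, V, hV, -, hVne, hVs⟩ := exists_open_subset_of_iUnion_closed (K := K)
    isOpen_univ (by simpa using hne)
    (f := fun ij : ℕ × ℕ => separationSet K (d ij.1) (1 / ((ij.2 : ℝ) + 1) / 2))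
    (fun ij => isClosed_separationSet _ _ _) (by
      rintro z ⟨hz, -⟩
      obtain ⟨p, hp⟩ := exists_projection_transverse _ (hk z hz)
      obtain ⟨ε, hε, hpε⟩ := exists_mem_separationSet hp
      obtain ⟨j, hj⟩ := exists_nat_one_div_lt hε
      have hj0 : (0 : ℝ) < 1 / ((j : ℝ) + 1) := by positivity
      obtain ⟨i, hi⟩ := (TopologicalSpace.denseRange_denseSeq
        (E →L[ℝ] EuclideanSpace ℝ (Fin k))).exists_dist_lt p (half_pos hj0)
      rw [dist_eq_norm] at hi
      refine mem_iUnion.2 ⟨(i, j), separationSet_subset_of_norm_sub_le hi.le ?_⟩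
      exact separationSet_anti hj.le hpε)
  exact ⟨d i, _, V, by positivity, hV, hVne, hVs⟩

section Touching

variable {E F : Type*} [NormedAddCommGroup E] [NormedSpace ℝ E]
  [NormedAddCommGroup F] [InnerProductSpace ℝ F]

theorem exists_isCompact_subset_mem_nhdsWithin {X : Type*} [TopologicalSpace X] {K s : Set X}
    [LocallyCompactSpace K] {x : X} (hx : x ∈ K) (hs : s ∈ 𝓝[K] x) :
    ∃ C, IsCompact C ∧ C ⊆ K ∩ s ∧ C ∈ 𝓝[K] x := by
  rw [nhdsWithin_eq_map_subtype_coe hx] at hs ⊢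
  obtain ⟨t, ht, hts, htc⟩ := local_compact_nhds (mem_map.1 hs)
  refine ⟨Subtype.val '' t, htc.image continuous_subtype_val, ?_, image_mem_map ht⟩
  rintro _ ⟨z, hz, rfl⟩
  exact ⟨z.2, hts hz⟩

theorem isTouching_of_forall_norm_le {K : Set E} {p : E →L[ℝ] F} {x : E} {a : F}
    (h : ∀ᶠ y in 𝓝[K] x, ‖a - p x‖ ≤ ‖a - p y‖) :
    IsTouching K x ((innerSL ℝ (a - p x)).comp p) := by
  have h0 : Tendsto (fun y => y - x) (𝓝[K] x) (𝓝 0) := by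
    have : Tendsto (fun y => y - x) (𝓝 x) (𝓝 (x - x)) :=
      (continuous_id.sub continuous_const).tendsto x
    rw [sub_self] at this
    exact this.mono_left nhdsWithin_le_nhds
  have h1 : (fun y => ‖p‖ ^ 2 * ‖y - x‖ ^ 2) =o[𝓝[K] x] fun y => y - x :=
    ((isLittleO_norm_pow_id one_lt_two).comp_tendsto h0).const_mul_left _
  refine IsBigO.trans_isLittleO (IsBigO.of_bound 1 ?_) h1
  filter_upwards [h] with y hy
  rw [Real.norm_of_nonneg (le_max_right _ _), Real.norm_of_nonneg (by positivity), one_mul]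
  refine max_le ?_ (by positivity)
  have h2 : a - p y = (a - p x) - p (y - x) := by simp
  have h3 := norm_sub_sq_real (a - p x) (p (y - x))
  have h4 := pow_le_pow_left₀ (norm_nonneg _) hy 2
  have h5 := pow_le_pow_left₀ (norm_nonneg _) (p.le_opNorm (y - x)) 2
  rw [← h2] at h3
  rw [mul_pow] at h5
  simp only [ContinuousLinearMap.comp_apply, innerSL_apply_apply]
  nlinarith [sq_nonneg ‖p (y - x)‖]

theorem exists_isTouching_of_image_notMem_nhds {K U s : Set E} [LocallyCompactSpace K]
    {p : E →L[ℝ] F} {x : E} {c : ℝ} (hx : x ∈ K) (hU : U ∈ 𝓝 x) (hc : 0 < c)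
    (hinv : ∀ᶠ q in 𝓝[K ×ˢ K] (x, x), ‖q.1 - q.2‖ ≤ c * ‖p (q.1 - q.2)‖)
    (hs : s ∈ 𝓝 x) (hps : p '' (K ∩ s) ∉ 𝓝 (p x)) :
    ∃ y ∈ K ∩ U, ∃ v, v ≠ 0 ∧ IsTouching K y ((innerSL ℝ v).comp p) := by
  rw [nhdsWithin_prod_eq] at hinv
  obtain ⟨t, ht, htinv⟩ := eventually_prod_self_iff'.1 hinv
  obtain ⟨C, hC, hCs, hCx⟩ := exists_isCompact_subset_mem_nhdsWithin hx
    (inter_mem ht (mem_nhdsWithin_of_mem_nhds (inter_mem hU hs)))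
  obtain ⟨ρ, hρ, hρC⟩ := Metric.mem_nhdsWithin_iff.1 hCx
  have hxC : x ∈ C := mem_of_mem_nhdsWithin hx hCx
  have hpC : p '' C ∉ 𝓝 (p x) := fun h => hps
    (mem_of_superset h (image_mono fun y hy => ⟨(hCs hy).1, (hCs hy).2.2.2⟩))
  have hδ : 0 < ρ / (2 * c) := by positivity
  obtain ⟨a, ha, haC⟩ : ∃ a ∈ ball (p x) (ρ / (2 * c)), a ∉ p '' C := by
    by_contra! h
    exact hpC (mem_of_superset (ball_mem_nhds _ hδ) h)
  obtain ⟨y, hyC, hy⟩ := hC.exists_isMinOn ⟨x, hxC⟩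
    (f := fun y => ‖a - p y‖) (by fun_prop)
  have hyK := hCs hyC
  have hyx : ‖a - p y‖ ≤ ‖a - p x‖ := hy hxC
  have hball : y ∈ ball x ρ := by
    have h1 := htinv y hyK.2.1 x (hCs hxC).2.1
    rw [mem_ball, dist_eq_norm, lt_div_iff₀ (by positivity)] at ha
    have h2 : ‖p (y - x)‖ ≤ ‖a - p x‖ + ‖a - p y‖ := by
      have : p (y - x) = (a - p x) - (a - p y) := by simp
      rw [this]
      exact norm_sub_le _ _
    rw [mem_ball, dist_eq_norm]
    nlinarith
  refine ⟨y, ⟨hyK.1, hyK.2.2.1⟩, a - p y, fun h => haC ⟨y, hyC, (sub_eq_zero.1 h).symm⟩, ?_⟩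
  refine isTouching_of_forall_norm_le ?_
  filter_upwards [self_mem_nhdsWithin, mem_nhdsWithin_of_mem_nhds (isOpen_ball.mem_nhds hball)]
    with w hw hwb
  exact hy (hρC ⟨hwb, hw⟩)

theorem IsTouching.smul {K : Set E} {x : E} {l : E →L[ℝ] ℝ} (h : IsTouching K x l) {c : ℝ}
    (hc : 0 ≤ c) : IsTouching K x (c • l) := by
  refine (h.const_mul_left c).congr_left fun y => ?_
  rw [mul_max_of_nonneg _ _ hc, mul_zero]
  rfl

theorem exists_not_touching_of_separationSet [FiniteDimensional ℝ F] {K U : Set E}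
    [LocallyCompactSpace K] {p : E →L[ℝ] F} {ε : ℝ} (hε : 0 < ε) (hU : IsOpen U)
    (hne : (K ∩ U).Nonempty) (hsep : K ∩ U ⊆ separationSet K p ε) :
    ∃ z ∈ K ∩ U, ∀ u : F, ‖u‖ = 1 → ¬ IsTouching K z ((innerSL ℝ u).comp p) := by
  by_contra! H
  obtain ⟨z₀, hz₀⟩ := hne
  obtain ⟨u₀, hu₀, -⟩ := H z₀ hz₀
  have : Nonempty (sphere (0 : F) 1) := ⟨⟨u₀, by simpa using hu₀⟩⟩
  let d := TopologicalSpace.denseSeq (sphere (0 : F) 1)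
  obtain ⟨⟨i, j⟩, V, hV, hVU, ⟨z, hzK, hzV⟩, hVs⟩ := exists_open_subset_of_iUnion_closed (K := K)
    hU ⟨z₀, hz₀⟩
    (f := fun ij : ℕ × ℕ => {z | ∀ y ∈ K, dist y z < 1 / ((ij.2 : ℝ) + 1) →
      inner ℝ (d ij.1 : F) (p (y - z)) ≤ ε / 2 * ‖y - z‖})
    (fun ij => by
      simp only [ofPred_forall]
      refine isClosed_iInter fun y => isClosed_iInter fun _ => ?_
      exact isClosed_imp (isOpen_lt (by fun_prop) (by fun_prop))
        (isClosed_le (by fun_prop) (by fun_prop)))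
    (by
      intro z hz
      obtain ⟨u, hu, ht⟩ := H z hz
      have hδ : 0 < ε / 4 / (‖p‖ + 1) := by positivity
      obtain ⟨i, hi⟩ := (TopologicalSpace.denseRange_denseSeq (sphere (0 : F) 1)).exists_dist_lt
        ⟨u, by simpa using hu⟩ hδ
      have hb := IsLittleO.bound ht (c := ε / 4) (by positivity)
      obtain ⟨r, hr, hrb⟩ := Metric.mem_nhdsWithin_iff.1 hb
      obtain ⟨j, hj⟩ := exists_nat_one_div_lt hr
      refine mem_iUnion.2 ⟨(i, j), fun y hy hyz => ?_⟩
      have h1 : ‖max (inner ℝ u (p (y - z))) 0‖ ≤ ε / 4 * ‖y - z‖ := hrb ⟨hyz.trans hj, hy⟩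
      rw [Real.norm_of_nonneg (le_max_right _ _)] at h1
      have h2 := (le_max_left _ _).trans h1
      have h3 : inner ℝ (d i : F) (p (y - z)) =
          inner ℝ u (p (y - z)) - inner ℝ (u - d i) (p (y - z)) := by
        rw [inner_sub_left]; ring
      have h4 : |inner ℝ (u - d i) (p (y - z))| ≤ ‖u - d i‖ * (‖p‖ * ‖y - z‖) :=
        (abs_real_inner_le_norm _ _).trans
          (mul_le_mul_of_nonneg_left (p.le_opNorm _) (norm_nonneg _))
      have h5 : ‖u - d i‖ * ‖p‖ ≤ ε / 4 := by
        rw [Subtype.dist_eq, dist_eq_norm, lt_div_iff₀ (by positivity)] at hi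
        have : ‖u - d i‖ * (‖p‖ + 1) < ε / 4 := hi
        nlinarith [norm_nonneg (u - d i), norm_nonneg p]
      have h6 := mul_le_mul_of_nonneg_right h5 (norm_nonneg (y - z))
      have h7 := neg_abs_le (inner ℝ (u - d i) (p (y - z)))
      show inner ℝ (d i : F) (p (y - z)) ≤ ε / 2 * ‖y - z‖
      linarith)
  have hj : (0 : ℝ) < 1 / ((j : ℝ) + 1) / 2 := by positivity
  have hW : V ∩ ball z (1 / ((j : ℝ) + 1) / 2) ∈ 𝓝 z :=
    inter_mem (hV.mem_nhds hzV) (ball_mem_nhds _ hj)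
  have hd : ‖(d i : F)‖ = 1 := by simp
  obtain ⟨⟨y, y'⟩, ⟨hyW, hyW'⟩, ⟨hyK, hyK'⟩, hlt⟩ := mem_closure_iff_nhds.1
    (hsep ⟨hzK, hVU hzV⟩ (d i) hd) _ (prod_mem_nhds hW hW)
  have hdist : dist y y' < 1 / ((j : ℝ) + 1) := by
    have h1 := dist_triangle_right y y' z
    have h2 : dist y z < 1 / ((j : ℝ) + 1) / 2 := hyW.2
    have h3 : dist y' z < 1 / ((j : ℝ) + 1) / 2 := hyW'.2
    linarith
  have h1 : inner ℝ (d i : F) (p (y - y')) ≤ ε / 2 * ‖y - y'‖ :=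
    hVs ⟨hyK', hyW'.1⟩ y hyK hdist
  have h2 : inner ℝ (d i : F) (p (y' - y)) ≤ ε / 2 * ‖y' - y‖ :=
    hVs ⟨hyK, hyW.1⟩ y' hyK' (by rwa [dist_comm])
  rw [← neg_sub, map_neg, inner_neg_right, norm_neg] at h2
  have h3 : |inner ℝ (d i : F) (p (y - y'))| ≤ ε / 2 * ‖y - y'‖ := abs_le.2 ⟨by linarith, h1⟩
  have h4 : ε * ‖y - y'‖ < |inner ℝ (d i : F) (p (y - y'))| := hlt
  nlinarith [norm_nonneg (y - y')]

end Touching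

theorem contDiffOn_one_of_hasStrictFDerivAt {E F : Type*} [NormedAddCommGroup E] [NormedSpace ℝ E]
    [NormedAddCommGroup F] [NormedSpace ℝ F] {s : F → E} {W : Set F} (hW : IsOpen W)
    (h : ∀ a ∈ W, ∃ L : F →L[ℝ] E, HasStrictFDerivAt s L a) : ContDiffOn ℝ 1 s W := by
  have hf : ∀ a ∈ W, HasStrictFDerivAt s (fderiv ℝ s a) a := fun a ha => by
    obtain ⟨L, hL⟩ := h a ha
    rwa [hL.hasFDerivAt.fderiv]
  rw [← zero_add 1, contDiffOn_succ_iff_fderiv_of_isOpen hW]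
  refine ⟨fun a ha => (hf a ha).hasFDerivAt.differentiableAt.differentiableWithinAt, by simp,
    contDiffOn_zero.2 fun a ha => ContinuousAt.continuousWithinAt ?_⟩
  rw [Metric.continuousAt_iff']
  intro ε hε
  have h0 : HasStrictFDerivAt (fun b => s b - fderiv ℝ s a b)
      (0 : F →L[ℝ] E) a := by
    have := (hf a ha).sub (fderiv ℝ s a).hasStrictFDerivAt
    rwa [sub_self] at this
  obtain ⟨t, ht, hL⟩ := h0.exists_lipschitzOnWith_of_nnnorm_lt (Real.toNNReal (ε / 2))
    (by simpa using hε)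
  filter_upwards [eventually_mem_nhds_iff.2 ht, hW.mem_nhds ha] with b hb hbW
  have h1 : HasFDerivAt (fun b => s b - fderiv ℝ s a b) (fderiv ℝ s b - fderiv ℝ s a) b :=
    (hf b hbW).hasFDerivAt.sub (fderiv ℝ s a).hasFDerivAt
  have h2 := h1.le_of_lipschitzOn hb hL
  rw [Real.coe_toNNReal _ (by positivity)] at h2
  rw [dist_eq_norm]
  linarith

theorem exists_linear_chart {n k : ℕ} (p : EuclideanSpace ℝ (Fin n) →L[ℝ] EuclideanSpace ℝ (Fin k))
    (hp : Function.Surjective p) :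
    ∃ (Φ : EuclideanSpace ℝ (Fin n) ≃L[ℝ] EuclideanSpace ℝ (Fin n))
      (π : EuclideanSpace ℝ (Fin n) →L[ℝ] EuclideanSpace ℝ (Fin k))
      (ι : EuclideanSpace ℝ (Fin k) →L[ℝ] EuclideanSpace ℝ (Fin n)),
      (∀ b, π (ι b) = b) ∧ (∀ w, π (Φ w) = p w) ∧
      ∀ z, ι (π z) = z ↔ ∀ i : Fin n, k ≤ (i : ℕ) → z i = 0 := by
  have hkn : k ≤ n := by
    simpa using LinearMap.finrank_le_finrank_of_surjective (f := p.toLinearMap) hp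
  let π : EuclideanSpace ℝ (Fin n) →ₗ[ℝ] EuclideanSpace ℝ (Fin k) :=
    { toFun := fun z => WithLp.toLp 2 fun i => z (Fin.castLE hkn i)
      map_add' := fun _ _ => rfl
      map_smul' := fun _ _ => rfl }
  let ι : EuclideanSpace ℝ (Fin k) →ₗ[ℝ] EuclideanSpace ℝ (Fin n) :=
    { toFun := fun b => WithLp.toLp 2 fun j => if h : (j : ℕ) < k then b ⟨j, h⟩ else 0
      map_add' := fun a b => by ext j; by_cases h : (j : ℕ) < k <;> simp [h]
      map_smul' := fun c b => by ext j; by_cases h : (j : ℕ) < k <;> simp [h] }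
  have hπapp : ∀ z i, π z i = z (Fin.castLE hkn i) := fun _ _ => rfl
  have hιapp : ∀ b j, ι b j = if h : (j : ℕ) < k then b ⟨j, h⟩ else 0 := fun _ _ => rfl
  have hπι : ∀ b, π (ι b) = b := fun b => by ext i; simp [hπapp, hιapp]
  have hπ : Function.Surjective π := fun b => ⟨ι b, hπι b⟩
  have hker : Module.finrank ℝ (LinearMap.ker p.toLinearMap) =
      Module.finrank ℝ (LinearMap.ker π) := by
    have h1 := LinearMap.finrank_range_add_finrank_ker p.toLinearMap
    have h2 := LinearMap.finrank_range_add_finrank_ker π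
    rw [LinearMap.range_eq_top.2 hp] at h1
    rw [LinearMap.range_eq_top.2 hπ] at h2
    omega
  let e := LinearEquiv.ofFinrankEq _ _ hker
  obtain ⟨r, hr⟩ := p.toLinearMap.exists_rightInverse_of_surjective (LinearMap.range_eq_top.2 hp)
  have hr' : ∀ b, p (r b) = b := fun b => congrArg (fun f => f b) hr
  let c : EuclideanSpace ℝ (Fin n) →ₗ[ℝ] LinearMap.ker p.toLinearMap :=
    (LinearMap.id - r.comp p.toLinearMap).codRestrict _ fun w => by simp [hr']
  let f : EuclideanSpace ℝ (Fin n) →ₗ[ℝ] EuclideanSpace ℝ (Fin n) :=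
    ι.comp p.toLinearMap + (LinearMap.ker π).subtype.comp (e.toLinearMap.comp c)
  have hf : ∀ w, π (f w) = p w := fun w => by
    have : π (e (c w)) = 0 := (e (c w)).2
    simp [f, hπι, this]
  have hinj : Function.Injective f := by
    refine (injective_iff_map_eq_zero f).2 fun w hw => ?_
    have hpw : p w = 0 := by rw [← hf, hw, map_zero]
    have h1 : e (c w) = 0 := by
      ext1
      simpa [f, hpw] using hw
    have h2 : c w = 0 := by simpa using h1
    simpa [c, hpw] using congrArg Subtype.val h2
  refine ⟨(LinearEquiv.ofInjectiveEndo f hinj).toContinuousLinearEquiv,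
    LinearMap.toContinuousLinearMap π, LinearMap.toContinuousLinearMap ι, hπι, hf, fun z => ?_⟩
  constructor
  · intro h i hi
    rw [← h]
    simp [hιapp, not_lt.2 hi]
  · intro h
    ext j
    by_cases hj : (j : ℕ) < k
    · simp [hιapp, hπapp, hj]
    · simp [hιapp, hj, h j (not_lt.1 hj)]

theorem hasStrictFDerivAt_of_rightInverse {E F : Type*} [NormedAddCommGroup E] [NormedSpace ℝ E]
    [NormedAddCommGroup F] [NormedSpace ℝ F] {K : Set E} {p : E →L[ℝ] F} {s : F → E} {W : Set F}
    (hW : IsOpen W) {c : ℝ} (hK : ∀ a ∈ W, s a ∈ K) (hps : ∀ a ∈ W, p (s a) = a)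
    (hs : ∀ a ∈ W, ∀ b ∈ W, ‖s a - s b‖ ≤ c * ‖a - b‖) {a : F} (ha : a ∈ W) {L : F →L[ℝ] E}
    (hL : (fun q : E × E => (q.1 - q.2) - L (p (q.1 - q.2)))
      =o[𝓝[K ×ˢ K] (s a, s a)] fun q => q.1 - q.2) : HasStrictFDerivAt s L a := by
  have hWa : W ∈ 𝓝 a := hW.mem_nhds ha
  have hcont : Tendsto s (𝓝 a) (𝓝[K] (s a)) := by
    refine tendsto_nhdsWithin_iff.2 ⟨?_, by filter_upwards [hWa] with b hb using hK b hb⟩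
    rw [tendsto_iff_norm_sub_tendsto_zero]
    have h0 : Tendsto (fun b => c * ‖b - a‖) (𝓝 a) (𝓝 0) := by
      have : Continuous fun b => c * ‖b - a‖ := by fun_prop
      simpa using this.tendsto a
    refine squeeze_zero' (Eventually.of_forall fun b => norm_nonneg _) ?_ h0
    filter_upwards [hWa] with b hb using hs b hb a ha
  have ht : Tendsto (fun q : F × F => (s q.1, s q.2)) (𝓝 (a, a)) (𝓝[K ×ˢ K] (s a, s a)) := by
    rw [nhdsWithin_prod_eq, nhds_prod_eq]
    exact hcont.prodMap hcont
  have hWW : W ×ˢ W ∈ 𝓝 (a, a) := prod_mem_nhds hWa hWa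
  have hO : (fun q : F × F => s q.1 - s q.2) =O[𝓝 (a, a)] fun q => q.1 - q.2 :=
    IsBigO.of_bound c (by filter_upwards [hWW] with q hq using hs _ hq.1 _ hq.2)
  refine HasStrictFDerivAt.of_isLittleO (((hL.comp_tendsto ht).trans_isBigO hO).congr' ?_
    EventuallyEq.rfl)
  filter_upwards [hWW] with q hq
  simp [hps _ hq.1, hps _ hq.2]

/-- A set which is the bijective image of an open set under an inverse of a linear projection,
and has secants controlled to first order, is a graph chart of class `C¹`. -/
theorem exists_chart_of_image_mem_nhds {n k : ℕ} {K V : Set (EuclideanSpace ℝ (Fin n))}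
    {p : EuclideanSpace ℝ (Fin n) →L[ℝ] EuclideanSpace ℝ (Fin k)} (hp : Function.Surjective p)
    (hV : IsOpen V) {c : ℝ} (hc : ∀ y ∈ K ∩ V, ∀ z ∈ K ∩ V, ‖y - z‖ ≤ c * ‖p (y - z)‖)
    (hL : ∀ z ∈ K ∩ V, ∃ L : EuclideanSpace ℝ (Fin k) →L[ℝ] EuclideanSpace ℝ (Fin n),
      (fun q : EuclideanSpace ℝ (Fin n) × EuclideanSpace ℝ (Fin n) =>
        (q.1 - q.2) - L (p (q.1 - q.2))) =o[𝓝[K ×ˢ K] (z, z)] fun q => q.1 - q.2)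
    {x : EuclideanSpace ℝ (Fin n)} (hx : x ∈ K ∩ V) (hpx : p '' (K ∩ V) ∈ 𝓝 (p x)) :
    ∃ (O O' : Set (EuclideanSpace ℝ (Fin n)))
      (h h' : EuclideanSpace ℝ (Fin n) → EuclideanSpace ℝ (Fin n)),
      IsOpen O ∧ IsOpen O' ∧ x ∈ O ∧ IsC1DiffeoOn h h' O O' ∧
      h '' (O ∩ K) = O' ∩ {z : EuclideanSpace ℝ (Fin n) | ∀ i : Fin n, k ≤ (i : ℕ) → z i = 0} := by
  obtain ⟨Φ, π, ι, hπι, hπΦ, hιπ⟩ := exists_linear_chart p hp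
  let W := interior (p '' (K ∩ V))
  have hW : IsOpen W := isOpen_interior
  have hxW : p x ∈ W := mem_interior_iff_mem_nhds.2 hpx
  have hex : ∀ a, ∃ w, a ∈ W → w ∈ K ∩ V ∧ p w = a := fun a => by
    by_cases ha : a ∈ W
    · obtain ⟨w, hw, hwa⟩ := interior_subset ha
      exact ⟨w, fun _ => ⟨hw, hwa⟩⟩
    · exact ⟨0, fun h => (ha h).elim⟩
  choose s hs using hex
  have hsp : ∀ w ∈ K ∩ V, p w ∈ W → s (p w) = w := fun w hw hpw => by
    have h1 := hc _ (hs _ hpw).1 w hw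
    rw [map_sub, (hs _ hpw).2, sub_self, norm_zero, mul_zero] at h1
    exact sub_eq_zero.1 (norm_le_zero_iff.1 h1)
  have hsC : ContDiffOn ℝ 1 s W := contDiffOn_one_of_hasStrictFDerivAt hW fun a ha => by
    obtain ⟨L, hL⟩ := hL _ (hs a ha).1
    refine ⟨L, hasStrictFDerivAt_of_rightInverse hW (fun a ha => (hs a ha).1.1)
      (fun a ha => (hs a ha).2) (c := c) (fun a ha b hb => ?_) ha hL⟩
    have := hc _ (hs a ha).1 _ (hs b hb).1
    rwa [map_sub, (hs a ha).2, (hs b hb).2] at this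
  let h : EuclideanSpace ℝ (Fin n) → EuclideanSpace ℝ (Fin n) :=
    fun w => Φ w - Φ (s (p w)) + ι (p w)
  let h' : EuclideanSpace ℝ (Fin n) → EuclideanSpace ℝ (Fin n) :=
    fun z => Φ.symm (z + Φ (s (π z)) - ι (π z))
  have hπh : ∀ w, p w ∈ W → π (h w) = p w := fun w hw => by
    simp [h, hπι, hπΦ, (hs _ hw).2]
  have hph' : ∀ z, π z ∈ W → p (h' z) = π z := fun z hz => by
    rw [← hπΦ]
    simp [h', hπι, hπΦ, (hs _ hz).2]
  have hleft : ∀ w, p w ∈ W → h' (h w) = w := fun w hw => by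
    simp only [h', hπh w hw]
    simp only [h, map_add, map_sub, Φ.symm_apply_apply]
    abel
  have hright : ∀ z, π z ∈ W → h (h' z) = z := fun z hz => by
    simp only [h, hph' z hz]
    simp only [h', Φ.apply_symm_apply]
    abel
  have hh : ContDiffOn ℝ 1 h (p ⁻¹' W) := by
    have h1 : ContDiffOn ℝ 1 (fun w => s (p w)) (p ⁻¹' W) :=
      hsC.comp p.contDiff.contDiffOn fun _ hw => hw
    exact (Φ.contDiff.contDiffOn.sub (Φ.contDiff.comp_contDiffOn h1)).add
      (ι.contDiff.comp p.contDiff).contDiffOn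
  have hh' : ContDiffOn ℝ 1 h' (π ⁻¹' W) := by
    have h1 : ContDiffOn ℝ 1 (fun w => s (π w)) (π ⁻¹' W) :=
      hsC.comp π.contDiff.contDiffOn fun _ hw => hw
    exact Φ.symm.contDiff.comp_contDiffOn
      ((contDiffOn_id.add (Φ.contDiff.comp_contDiffOn h1)).sub
        (ι.contDiff.comp π.contDiff).contDiffOn)
  have himg : h '' (V ∩ p ⁻¹' W) = π ⁻¹' W ∩ h' ⁻¹' V := by
    ext z
    constructor
    · rintro ⟨w, ⟨hwV, hwW⟩, rfl⟩
      refine ⟨?_, ?_⟩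
      · rw [mem_preimage, hπh w hwW]
        exact hwW
      · rw [mem_preimage, hleft w hwW]
        exact hwV
    · rintro ⟨hzW, hzV⟩
      refine ⟨h' z, ⟨hzV, ?_⟩, hright z hzW⟩
      rw [mem_preimage, hph' z hzW]
      exact hzW
  refine ⟨V ∩ p ⁻¹' W, π ⁻¹' W ∩ h' ⁻¹' V, h, h', hV.inter (hW.preimage p.continuous),
    hh'.continuousOn.isOpen_inter_preimage (hW.preimage π.continuous) hV, ⟨hx.2, hxW⟩,
    ⟨hh.mono inter_subset_right, hh'.mono inter_subset_left, himg,
      fun w hw => hleft w hw.2, fun z hz => hright z hz.1⟩, ?_⟩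
  ext z
  constructor
  · rintro ⟨w, ⟨hw, hwK⟩, rfl⟩
    refine ⟨himg ▸ mem_image_of_mem h hw, (hιπ _).1 ?_⟩
    rw [hπh w hw.2]
    simp [h, hsp w ⟨hwK, hw.1⟩ hw.2]
  · rintro ⟨hz, hz0⟩
    have hιz := (hιπ z).2 hz0
    obtain ⟨w, hw, rfl⟩ : z ∈ h '' (V ∩ p ⁻¹' W) := himg ▸ hz
    rw [hπh w hw.2] at hιz
    have h0 : Φ w - Φ (s (p w)) = 0 := by simpa [h] using hιz
    have h1 : Φ w = Φ (s (p w)) := sub_eq_zero.1 h0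
    refine ⟨w, ⟨hw, ?_⟩, rfl⟩
    rw [Φ.injective h1]
    exact (hs _ hw.2).1.1

/-- Pulling back a chart along a local diffeomorphism of the pair. -/
theorem exists_chart_of_diffeo {n : ℕ} {K P : Set (EuclideanSpace ℝ (Fin n))}
    {x y : EuclideanSpace ℝ (Fin n)} {Ox Oy O O' : Set (EuclideanSpace ℝ (Fin n))}
    {g g' h h' : EuclideanSpace ℝ (Fin n) → EuclideanSpace ℝ (Fin n)}
    (hOx : IsOpen Ox) (hOy : IsOpen Oy) (hx : x ∈ Ox) (hg : IsC1DiffeoOn g g' Ox Oy)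
    (hgK : g '' (Ox ∩ K) = Oy ∩ K) (hgx : g x = y)
    (hO : IsOpen O) (hO' : IsOpen O') (hy : y ∈ O) (hh : IsC1DiffeoOn h h' O O')
    (hhK : h '' (O ∩ K) = O' ∩ P) :
    ∃ (V V' : Set (EuclideanSpace ℝ (Fin n)))
      (f f' : EuclideanSpace ℝ (Fin n) → EuclideanSpace ℝ (Fin n)),
      IsOpen V ∧ IsOpen V' ∧ x ∈ V ∧ IsC1DiffeoOn f f' V V' ∧ f '' (V ∩ K) = V' ∩ P := by
  obtain ⟨hg1, hg2, hg3, hg4, hg5⟩ := hg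
  obtain ⟨hh1, hh2, hh3, hh4, hh5⟩ := hh
  have hgm : ∀ w ∈ Ox, g w ∈ Oy := fun w hw => hg3 ▸ mem_image_of_mem g hw
  have hgm' : ∀ w ∈ Oy, g' w ∈ Ox := fun w hw => by
    obtain ⟨v, hv, rfl⟩ := hg3.symm ▸ hw
    rwa [hg4 v hv]
  have hhm : ∀ w ∈ O, h w ∈ O' := fun w hw => hh3 ▸ mem_image_of_mem h hw
  have hhm' : ∀ w ∈ O', h' w ∈ O := fun w hw => by
    obtain ⟨v, hv, rfl⟩ := hh3.symm ▸ hw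
    rwa [hh4 v hv]
  have himg : (h ∘ g) '' (Ox ∩ g ⁻¹' O) = O' ∩ h' ⁻¹' Oy := by
    ext z
    constructor
    · rintro ⟨w, ⟨hw, hwO⟩, rfl⟩
      refine ⟨hhm _ hwO, ?_⟩
      rw [mem_preimage, Function.comp_apply, hh4 _ hwO]
      exact hgm w hw
    · rintro ⟨hz, hzO⟩
      refine ⟨g' (h' z), ⟨hgm' _ hzO, ?_⟩, ?_⟩
      · rw [mem_preimage, hg5 _ hzO]
        exact hhm' z hz
      · rw [Function.comp_apply, hg5 _ hzO, hh5 z hz]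
  refine ⟨Ox ∩ g ⁻¹' O, O' ∩ h' ⁻¹' Oy, h ∘ g, g' ∘ h',
    hg1.continuousOn.isOpen_inter_preimage hOx hO,
    hh2.continuousOn.isOpen_inter_preimage hO' hOy, ⟨hx, by rwa [mem_preimage, hgx]⟩,
    ⟨hh1.comp (hg1.mono inter_subset_left) fun w hw => hw.2,
      hg2.comp (hh2.mono inter_subset_left) fun w hw => hw.2, himg, fun w hw => ?_,
      fun z hz => ?_⟩, ?_⟩
  · rw [Function.comp_apply, Function.comp_apply, hh4 _ hw.2, hg4 _ hw.1]
  · rw [Function.comp_apply, Function.comp_apply, hg5 _ hz.2, hh5 _ hz.1]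
  ext z
  constructor
  · rintro ⟨w, ⟨hw, hwK⟩, rfl⟩
    have h1 : g w ∈ Oy ∩ K := hgK ▸ mem_image_of_mem g ⟨hw.1, hwK⟩
    have h2 : h (g w) ∈ O' ∩ P := hhK ▸ mem_image_of_mem h ⟨hw.2, h1.2⟩
    exact ⟨himg ▸ mem_image_of_mem _ hw, h2.2⟩
  · rintro ⟨hz, hzP⟩
    obtain ⟨v, ⟨hv, hvK⟩, rfl⟩ : z ∈ h '' (O ∩ K) := hhK ▸ ⟨hz.1, hzP⟩
    have hvy : v ∈ Oy := by
      have := hz.2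
      rwa [mem_preimage, hh4 v hv] at this
    obtain ⟨w, ⟨hw, hwK⟩, rfl⟩ : v ∈ g '' (Ox ∩ K) := hgK ▸ ⟨hvy, hvK⟩
    exact ⟨w, ⟨⟨hw, hv⟩, hwK⟩, rfl⟩

theorem surjective_of_comp_ne_zero {E F : Type*} [NormedAddCommGroup E] [NormedSpace ℝ E]
    [NormedAddCommGroup F] [InnerProductSpace ℝ F] [FiniteDimensional ℝ F] {p : E →L[ℝ] F}
    (h : ∀ u : F, u ≠ 0 → (innerSL ℝ u).comp p ≠ 0) : Function.Surjective p := by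
  suffices H : (LinearMap.range p.toLinearMap) = ⊤ from LinearMap.range_eq_top.1 H
  rw [← Submodule.orthogonal_eq_bot_iff, eq_bot_iff]
  intro u hu
  by_contra h0
  refine h u h0 (ContinuousLinearMap.ext fun w => ?_)
  have h1 := (Submodule.mem_orthogonal' _ _).1 hu (p w) ⟨w, rfl⟩
  simpa using h1

theorem exists_eventually_norm_le_of_isLittleO {E F : Type*} [NormedAddCommGroup E]
    [NormedSpace ℝ E] [NormedAddCommGroup F] [NormedSpace ℝ F] {p : E →L[ℝ] F} {L : F →L[ℝ] E}
    {l : Filter (E × E)}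
    (h : (fun q : E × E => (q.1 - q.2) - L (p (q.1 - q.2))) =o[l] fun q => q.1 - q.2) :
    ∃ c > 0, ∀ᶠ q in l, ‖q.1 - q.2‖ ≤ c * ‖p (q.1 - q.2)‖ := by
  refine ⟨2 * ‖L‖ + 1, by positivity, ?_⟩
  filter_upwards [h.bound one_half_pos] with q hq
  generalize q.1 - q.2 = w at hq
  have h1 := norm_sub_norm_le w (L (p w))
  have h2 := L.le_opNorm (p w)
  have h3 := norm_nonneg (p w)
  linarith

/-- If some point admits a touching functional along the projection `p`, then homogeneity spreads
it to every point of `K ∩ U`, which is impossible. -/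
theorem IsC1Homogeneous.not_isTouching {n : ℕ} {K U : Set (EuclideanSpace ℝ (Fin n))}
    [LocallyCompactSpace K] (hK : IsC1Homogeneous K) {F : Type*} [NormedAddCommGroup F]
    [InnerProductSpace ℝ F] [FiniteDimensional ℝ F] {p : EuclideanSpace ℝ (Fin n) →L[ℝ] F}
    {ε : ℝ} (hε : 0 < ε) (hU : IsOpen U) (hsep : K ∩ U ⊆ separationSet K p ε)
    (hdec : ∀ z ∈ K ∩ U, ∀ l : EuclideanSpace ℝ (Fin n) →L[ℝ] ℝ,
      ∃ u : F, ∃ e ∈ conormal K z, l = (innerSL ℝ u).comp p + e)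
    {y : EuclideanSpace ℝ (Fin n)} (hy : y ∈ K ∩ U) {v : F} (hv : v ≠ 0) :
    ¬ IsTouching K y ((innerSL ℝ v).comp p) := by
  intro ht
  obtain ⟨z, hz, hzt⟩ := exists_not_touching_of_separationSet hε hU ⟨y, hy⟩ hsep
  obtain ⟨l, hl, hln⟩ :=
    (hK.hasMove hz.1 hy.1).exists_touching ht (comp_notMem_conormal hε (hsep hy) hv)
  obtain ⟨u, e, he, rfl⟩ := hdec z hz l
  have hu : u ≠ 0 := by
    rintro rfl
    refine hln ?_
    simpa using he
  have h1 := (hl.add_conormal hz.1 (neg_mem he)).smul (inv_nonneg.2 (norm_nonneg u))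
  refine hzt (‖u‖⁻¹ • u) (norm_smul_inv_norm hu) ?_
  convert h1 using 1
  ext w
  simp

/-- (Repovš–Skopenkov–Ščepin) A locally compact `C¹`-homogeneous subset of `ℝⁿ`
is a `C¹`-submanifold of `ℝⁿ`. -/
theorem c1_homogeneous_subsets_are_c1_submanifolds (n : ℕ)
    (K : Set (EuclideanSpace ℝ (Fin n))) (hK : LocallyCompactSpace K)
    (hhom : IsC1Homogeneous K) :
    ∀ x ∈ K, ∃ (d : ℕ) (O O' : Set (EuclideanSpace ℝ (Fin n)))
      (h h' : EuclideanSpace ℝ (Fin n) → EuclideanSpace ℝ (Fin n)),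
      IsOpen O ∧ IsOpen O' ∧ x ∈ O ∧ IsC1DiffeoOn h h' O O' ∧
      h '' (O ∩ K) = O' ∩ {z : EuclideanSpace ℝ (Fin n) | ∀ i : Fin n, d ≤ (i : ℕ) → z i = 0} := by
  intro x hx
  obtain ⟨k, hk⟩ : ∃ k, ∀ z ∈ K, Module.finrank ℝ (conormal K z) + k =
      Module.finrank ℝ (EuclideanSpace ℝ (Fin n)) := by
    refine ⟨Module.finrank ℝ (EuclideanSpace ℝ (Fin n)) - Module.finrank ℝ (conormal K x),
      fun z hz => ?_⟩
    have h1 := (hhom.hasMove hx hz).finrank_le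
    have h2 := (hhom.hasMove hz hx).finrank_le
    have h3 := Submodule.finrank_le (conormal K x)
    rw [finrank_continuousLinearMap_real] at h3
    omega
  obtain ⟨p, ε, U, hε, hU, ⟨x₀, hx₀⟩, hsep⟩ := exists_open_subset_separationSet ⟨x, hx⟩ hk
  have hdec : ∀ z ∈ K ∩ U, ∀ l : EuclideanSpace ℝ (Fin n) →L[ℝ] ℝ,
      ∃ u, ∃ e ∈ conormal K z, l = (innerSL ℝ u).comp p + e := fun z hz =>
    exists_sub_mem_conormal (by simpa using hk z hz.1)
      fun u hu => comp_notMem_conormal hε (hsep hz) hu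
  have hL := fun z hz => exists_linear_inverse_isLittleO (hdec z hz)
  have hp : Function.Surjective p := surjective_of_comp_ne_zero fun u hu h0 =>
    comp_notMem_conormal hε (hsep hx₀) hu (h0 ▸ zero_mem _)
  obtain ⟨L, hL₀⟩ := hL x₀ hx₀
  obtain ⟨c, hc, hinv⟩ := exists_eventually_norm_le_of_isLittleO hL₀
  have hinv' := hinv
  rw [nhdsWithin_prod_eq] at hinv'
  obtain ⟨t, ht, hct⟩ := eventually_prod_self_iff'.1 hinv'
  obtain ⟨V₀, hV₀, hxV₀, hVt⟩ := mem_nhdsWithin.1 ht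
  have hV : IsOpen (V₀ ∩ U) := hV₀.inter hU
  have hxV : x₀ ∈ V₀ ∩ U := ⟨hxV₀, hx₀.2⟩
  have himg : p '' (K ∩ (V₀ ∩ U)) ∈ 𝓝 (p x₀) := by
    by_contra h
    obtain ⟨y, hy, v, hv, hyv⟩ := exists_isTouching_of_image_notMem_nhds hx₀.1
      (hU.mem_nhds hx₀.2) hc hinv (hV.mem_nhds hxV) h
    exact hhom.not_isTouching hε hU hsep hdec hy hv hyv
  obtain ⟨O, O', h, h', hO, hO', hxO, hh, hhK⟩ := exists_chart_of_image_mem_nhds hp hV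
    (fun y hy z hz => hct y (hVt ⟨hy.2.1, hy.1⟩) z (hVt ⟨hz.2.1, hz.1⟩))
    (fun z hz => hL z ⟨hz.1, hz.2.2⟩) ⟨hx₀.1, hxV⟩ himg
  obtain ⟨Ox, Oy, g, g', hOx, hOy, hxOx, -, hg, hgK, hgx⟩ := hhom x hx x₀ hx₀.1
  exact ⟨k, exists_chart_of_diffeo hOx hOy hxOx hg hgK hgx hO hO' hxO hh hhK⟩
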